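/- If for every i = 1,…,N the blocks satisfy: S_i symmetric with 0 ⪯ S_i ≺ (1/(3d_i))I, 0 ≺ R_i ≺ (1/(2d_i))I, and Q_i + S_i ≺ −4d_i I, then the global LMI under Laplacian coupling holds: Q − SL − LSᵀ + LRL ≺ 0. -/

import Mathlib

open Matrix Kronecker

/-- Block-diagonal matrix built from `N` blocks of size `a × b`. -/
def blkDiag {N a b : ℕ} (M : Fin N → Matrix (Fin a) (Fin b) ℝ) :
    Matrix (Fin N × Fin a) (Fin N × Fin b) ℝ :=
  Matrix.of fun x y => if x.1 = y.1 then M x.1 x.2 y.2 else 0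

theorem blkDiag_mulVec {N a b : ℕ} (M : Fin N → Matrix (Fin a) (Fin b) ℝ)
    (x : Fin N × Fin b → ℝ) (i : Fin N) :
    (fun k => (blkDiag M *ᵥ x) (i, k)) = M i *ᵥ fun k => x (i, k) := by
  funext k
  simp [blkDiag, mulVec, dotProduct, Fintype.sum_prod_type, ite_mul, Finset.sum_ite_irrel]

theorem dotProduct_blkDiag_mulVec {N a b : ℕ} (M : Fin N → Matrix (Fin a) (Fin b) ℝ)
    (x : Fin N × Fin a → ℝ) (y : Fin N × Fin b → ℝ) :
    x ⬝ᵥ (blkDiag M *ᵥ y) =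
      ∑ i, (fun k => x (i, k)) ⬝ᵥ (M i *ᵥ fun k => y (i, k)) := by
  rw [dotProduct, Fintype.sum_prod_type]
  refine Finset.sum_congr rfl fun i _ => ?_
  rw [← blkDiag_mulVec]
  rfl

theorem blkDiag_isSymm {N a : ℕ} {M : Fin N → Matrix (Fin a) (Fin a) ℝ}
    (h : ∀ i, (M i).IsSymm) : (blkDiag M).IsSymm := by
  ext ⟨i, k⟩ ⟨j, l⟩
  by_cases hij : i = j
  · subst hij
    simpa [blkDiag] using (h i).apply k l
  · simp [blkDiag, hij, Ne.symm hij]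

theorem kronecker_one_mulVec {ι κ : Type*} [Fintype ι] [Fintype κ] [DecidableEq κ]
    (A : Matrix ι ι ℝ) (x : ι × κ → ℝ) (i : ι) (k : κ) :
    ((A ⊗ₖ (1 : Matrix κ κ ℝ)) *ᵥ x) (i, k) = (A *ᵥ fun j => x (j, k)) i := by
  simp [mulVec, dotProduct, Fintype.sum_prod_type, Matrix.one_apply]

/-- The normalized Laplacian of a weighted graph has spectral radius at most `2`. -/
theorem sum_laplacian_mulVec_sq_div_le {ι : Type*} [Fintype ι] [DecidableEq ι]
    {A : Matrix ι ι ℝ} (hsymm : A.IsSymm) (hnonneg : ∀ i j, 0 ≤ A i j)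
    {d : ι → ℝ} (hd : ∀ i, d i = ∑ j, A i j) (hdpos : ∀ i, 0 < d i) (w : ι → ℝ) :
    ∑ i, (((diagonal d - A) *ᵥ w) i) ^ 2 / d i ≤ 4 * ∑ i, d i * w i ^ 2 := by
  have hpoint : ∀ i, (((diagonal d - A) *ᵥ w) i) ^ 2 / d i ≤
      2 * (d i * w i ^ 2) + 2 * ∑ j, A i j * w j ^ 2 := by
    intro i
    have hcs : (∑ j, A i j * w j) ^ 2 ≤ (∑ j, A i j) * ∑ j, A i j * w j ^ 2 := by
      refine Finset.sum_sq_le_sum_mul_sum_of_sq_le_mul _ (fun j _ => hnonneg i j)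
        (fun j _ => mul_nonneg (hnonneg i j) (sq_nonneg _)) fun j _ => le_of_eq (by ring)
    rw [← hd i] at hcs
    have heq : ((diagonal d - A) *ᵥ w) i = d i * w i - ∑ j, A i j * w j := by
      rw [sub_mulVec, Pi.sub_apply, mulVec_diagonal]
      rfl
    rw [heq, div_le_iff₀ (hdpos i)]
    nlinarith [sq_nonneg (d i * w i + ∑ j, A i j * w j)]
  have hswap : ∑ i, ∑ j, A i j * w j ^ 2 = ∑ i, d i * w i ^ 2 := by
    rw [Finset.sum_comm]
    refine Finset.sum_congr rfl fun j _ => ?_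
    rw [← Finset.sum_mul, hd j]
    simp only [hsymm.apply j]
  calc _ ≤ ∑ i, (2 * (d i * w i ^ 2) + 2 * ∑ j, A i j * w j ^ 2) :=
        Finset.sum_le_sum fun i _ => hpoint i
    _ = 4 * ∑ i, d i * w i ^ 2 := by
        rw [Finset.sum_add_distrib, ← Finset.mul_sum, ← Finset.mul_sum, hswap]
        ring

theorem dotProduct_mulVec_comm_of_isSymm {ι : Type*} [Fintype ι] {A : Matrix ι ι ℝ}
    (h : A.IsSymm) (x y : ι → ℝ) : x ⬝ᵥ (A *ᵥ y) = y ⬝ᵥ (A *ᵥ x) := by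
  rw [dotProduct_mulVec, ← mulVec_transpose, h.eq, dotProduct_comm]

theorem neg_two_mul_dotProduct_mulVec_le {ι : Type*} [Fintype ι] {S : Matrix ι ι ℝ}
    (hS : S.PosSemidef) (hsymm : S.IsSymm) (x y : ι → ℝ) :
    -(2 * (x ⬝ᵥ (S *ᵥ y))) ≤ x ⬝ᵥ (S *ᵥ x) + y ⬝ᵥ (S *ᵥ y) := by
  have h := hS.dotProduct_mulVec_nonneg (x + y)
  simp only [star_trivial, mulVec_add, dotProduct_add, add_dotProduct] at h
  linarith [dotProduct_mulVec_comm_of_isSymm hsymm x y]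

theorem dotProduct_mulVec_le_of_posSemidef_smul_one_sub {ι : Type*} [Fintype ι] [DecidableEq ι]
    {A : Matrix ι ι ℝ} {c : ℝ} (h : (c • (1 : Matrix ι ι ℝ) - A).PosSemidef) (y : ι → ℝ) :
    y ⬝ᵥ (A *ᵥ y) ≤ c * (y ⬝ᵥ y) := by
  have := h.dotProduct_mulVec_nonneg y
  simp only [star_trivial, sub_mulVec, smul_mulVec, one_mulVec, dotProduct_sub,
    dotProduct_smul, smul_eq_mul] at this
  linarith

theorem block_quadratic_le {ι : Type*} [Fintype ι] [DecidableEq ι] {Q S R : Matrix ι ι ℝ} {d : ℝ}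
    (hd : 0 < d) (hSsymm : S.IsSymm) (hS : S.PosSemidef)
    (hSub : ((1 / (3 * d)) • (1 : Matrix ι ι ℝ) - S).PosSemidef)
    (hRub : ((1 / (2 * d)) • (1 : Matrix ι ι ℝ) - R).PosSemidef) (x y : ι → ℝ) :
    x ⬝ᵥ (Q *ᵥ x) - 2 * (x ⬝ᵥ (S *ᵥ y)) + y ⬝ᵥ (R *ᵥ y) ≤
      x ⬝ᵥ ((Q + S) *ᵥ x) + 5 / 6 * ((y ⬝ᵥ y) / d) := by
  have h1 := neg_two_mul_dotProduct_mulVec_le hS hSsymm x y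
  have h2 := dotProduct_mulVec_le_of_posSemidef_smul_one_sub hSub y
  have h3 := dotProduct_mulVec_le_of_posSemidef_smul_one_sub hRub y
  have h4 : 1 / (3 * d) * (y ⬝ᵥ y) + 1 / (2 * d) * (y ⬝ᵥ y) = 5 / 6 * ((y ⬝ᵥ y) / d) := by
    field_simp
    ring
  rw [add_mulVec, dotProduct_add]
  linarith

/-- Decentralized condition (c): if `0 ⪯ S_i ≺ (1/(3d_i))I`, `0 ≺ R_i ≺ (1/(2d_i))I` and
`Q_i + S_i ≺ −4d_iI`, then `Q − SL − LSᵀ + LRL ≺ 0` under Laplacian coupling. -/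
theorem decentralized_LMI_third {N m : ℕ}
    (𝒜 : Matrix (Fin N) (Fin N) ℝ)
    (h𝒜symm : 𝒜.IsSymm) (h𝒜nonneg : ∀ i j, 0 ≤ 𝒜 i j) (h𝒜diag : ∀ i, 𝒜 i i = 0)
    (d : Fin N → ℝ) (hd : ∀ i, d i = ∑ j, 𝒜 i j) (hdpos : ∀ i, 0 < d i)
    (ℒ : Matrix (Fin N) (Fin N) ℝ) (hℒ : ℒ = Matrix.diagonal d - 𝒜)
    (hconn : ∀ v : Fin N → ℝ, ℒ *ᵥ v = 0 → ∃ c : ℝ, v = fun _ => c)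
    (L : Matrix (Fin N × Fin m) (Fin N × Fin m) ℝ)
    (hL : L = ℒ ⊗ₖ (1 : Matrix (Fin m) (Fin m) ℝ))
    (Q S R : Fin N → Matrix (Fin m) (Fin m) ℝ)
    (hQsymm : ∀ i, (Q i).IsSymm) (hRsymm : ∀ i, (R i).IsSymm)
    (hSsymm : ∀ i, (S i).IsSymm)
    (hSpsd : ∀ i, (S i).PosSemidef)
    (hSub : ∀ i, ((1 / (3 * d i)) • (1 : Matrix (Fin m) (Fin m) ℝ) - S i).PosDef)
    (hRpos : ∀ i, (R i).PosDef)
    (hRub : ∀ i, ((1 / (2 * d i)) • (1 : Matrix (Fin m) (Fin m) ℝ) - R i).PosDef)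
    (hQSub : ∀ i, (-((4 * d i) • (1 : Matrix (Fin m) (Fin m) ℝ)) - (Q i + S i)).PosDef) :
    (-(blkDiag Q - blkDiag S * L - L * (blkDiag S)ᵀ + L * blkDiag R * L)).PosDef := by
  subst hL
  have hℒsymm : ℒ.IsSymm := by
    rw [hℒ]
    exact (isSymm_diagonal d).sub h𝒜symm
  set L := ℒ ⊗ₖ (1 : Matrix (Fin m) (Fin m) ℝ) with hL
  have hLsymm : Lᵀ = L := by
    rw [hL, ← kroneckerMap_transpose, hℒsymm.eq, transpose_one]
  have hQT := (blkDiag_isSymm hQsymm).eq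
  have hST := (blkDiag_isSymm hSsymm).eq
  have hRT := (blkDiag_isSymm hRsymm).eq
  refine PosDef.of_dotProduct_mulVec_pos ?_ fun x hx => ?_
  · rw [IsHermitian, conjTranspose_eq_transpose_of_trivial]
    simp only [transpose_neg, transpose_add, transpose_sub, transpose_mul, hLsymm, hQT, hST, hRT,
      Matrix.mul_assoc]
    abel
  · set y := L *ᵥ x with hy
    have hLdot : ∀ z, x ⬝ᵥ (L *ᵥ z) = y ⬝ᵥ z := fun z => by
      rw [dotProduct_mulVec_comm_of_isSymm hLsymm, dotProduct_comm]
    have hform : star x ⬝ᵥ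
        (-(blkDiag Q - blkDiag S * L - L * (blkDiag S)ᵀ + L * blkDiag R * L) *ᵥ x) =
        -∑ i, ((fun k => x (i, k)) ⬝ᵥ (Q i *ᵥ fun k => x (i, k))
          - 2 * ((fun k => x (i, k)) ⬝ᵥ (S i *ᵥ fun k => y (i, k)))
          + (fun k => y (i, k)) ⬝ᵥ (R i *ᵥ fun k => y (i, k))) := by
      rw [Finset.sum_add_distrib, Finset.sum_sub_distrib, ← Finset.mul_sum,
        ← dotProduct_blkDiag_mulVec, ← dotProduct_blkDiag_mulVec, ← dotProduct_blkDiag_mulVec,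
        hST, star_trivial]
      simp only [neg_mulVec, add_mulVec, sub_mulVec, ← mulVec_mulVec, dotProduct_neg,
        dotProduct_add, dotProduct_sub, hLdot, ← hy]
      rw [dotProduct_mulVec_comm_of_isSymm (blkDiag_isSymm hSsymm) y x]
      ring
    have hlap : ∑ i, ((fun k => y (i, k)) ⬝ᵥ fun k => y (i, k)) / d i ≤
        4 * ∑ i, d i * ((fun k => x (i, k)) ⬝ᵥ fun k => x (i, k)) := by
      simp only [dotProduct, Finset.sum_div, Finset.mul_sum]
      rw [Finset.sum_comm, Finset.sum_comm (γ := Fin N)]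
      refine Finset.sum_le_sum fun k _ => ?_
      have h := sum_laplacian_mulVec_sq_div_le h𝒜symm h𝒜nonneg hd hdpos fun j => x (j, k)
      rw [← hℒ, Finset.mul_sum] at h
      simpa only [hy, hL, kronecker_one_mulVec, ← pow_two] using h
    have hblock := Finset.sum_le_sum fun i (_ : i ∈ Finset.univ) =>
      block_quadratic_le (Q := Q i) (hdpos i) (hSsymm i) (hSpsd i) (hSub i).posSemidef
        (hRub i).posSemidef (fun k => x (i, k)) (fun k => y (i, k))
    have hQS : ∀ i, (fun k => x (i, k)) ≠ 0 →
        (fun k => x (i, k)) ⬝ᵥ ((Q i + S i) *ᵥ fun k => x (i, k)) <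
          -4 * (d i * ((fun k => x (i, k)) ⬝ᵥ fun k => x (i, k))) := fun i hi => by
      have h := (hQSub i).dotProduct_mulVec_pos hi
      simp only [star_trivial, sub_mulVec, neg_mulVec, smul_mulVec, one_mulVec, dotProduct_sub,
        dotProduct_neg, dotProduct_smul, smul_eq_mul] at h
      linarith
    have hQS' : ∑ i, (fun k => x (i, k)) ⬝ᵥ ((Q i + S i) *ᵥ fun k => x (i, k)) <
        ∑ i, -4 * (d i * ((fun k => x (i, k)) ⬝ᵥ fun k => x (i, k))) := by
      obtain ⟨⟨i, k⟩, hik⟩ := Function.ne_iff.mp hx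
      refine Finset.sum_lt_sum (fun j _ => ?_)
        ⟨i, Finset.mem_univ i, hQS i fun h => hik (congrFun h k)⟩
      by_cases hj : (fun k => x (j, k)) = 0
      · simp [hj]
      · exact (hQS j hj).le
    have hnonneg : 0 ≤ ∑ i, d i * ((fun k => x (i, k)) ⬝ᵥ fun k => x (i, k)) :=
      Finset.sum_nonneg fun i _ => mul_nonneg (hdpos i).le
        (Finset.sum_nonneg fun k _ => mul_self_nonneg _)
    rw [Finset.sum_add_distrib (f := fun i => (fun k => x (i, k)) ⬝ᵥ _),
      ← Finset.mul_sum] at hblock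
    rw [← Finset.mul_sum] at hQS'
    rw [hform]
    linarith
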